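/- arXiv:2409.18648 — 6 statements merged into one kernel-verified Lean document; each statement's English description precedes it below -/
import Mathlib

section
/- Let m, R, I, J > 0 and let (x, y, θ, φ) : U → ℝ⁴ be a twice differentiable curve on an open interval U ⊆ ℝ satisfying, for all t ∈ U, the geodesic equations of the principal metric of the vertical rolling disk: x'' = −(mR²/(2(I+mR²))) sin(2φ) x'φ' + (mR²/(I+mR²)) cos²(φ) y'φ' − R sin(φ) θ'φ', y'' = −(mR²/(I+mR²)) sin²(φ) x'φ' + (mR²/(2(I+mR²))) sin(2φ) y'φ' + R cos(φ) θ'φ', θ'' = −(mR/(I+mR²)) sin(φ) x'φ' + (mR/(I+mR²)) cos(φ) y'φ', φ'' = (mR/J) sin(φ) x'θ' − (mR/J) cos(φ) y'θ'. Then the functions t ↦ x'(t) − R θ'(t) cos(φ(t)) and t ↦ y'(t) − R θ'(t) sin(φ(t)) are constant on U. -/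
/-- A function whose derivative vanishes on an open order-connected set is constant there. -/
theorem eq_of_hasDerivAt_zero_of_ordConnected {U : Set ℝ} (hUopen : IsOpen U)
    (hUconn : U.OrdConnected) {f : ℝ → ℝ} (hf : ∀ t ∈ U, HasDerivAt f 0 t) :
    ∀ s ∈ U, ∀ t ∈ U, f s = f t := fun _ hs _ ht =>
  hUopen.is_const_of_deriv_eq_zero hUconn.isPreconnected
    (fun u hu => (hf u hu).differentiableAt.differentiableWithinAt)
    (fun u hu => (hf u hu).deriv) hs ht


/-- For the vertical rolling disk, along any twice differentiable solution of
the geodesic equations of the principal Riemannian metric `h` on an open interval `U`,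
the quantities `x' - R θ' cos φ` and `y' - R θ' sin φ` are constant on `U`. -/
theorem vertical_disk_geodesics_constraint_functions_constant
    (m R I J : ℝ) (hm : 0 < m) (hR : 0 < R) (hI : 0 < I) (hJ : 0 < J)
    (U : Set ℝ) (hUopen : IsOpen U) (hUconn : U.OrdConnected)
    (x y θ φ x' y' θ' φ' x'' y'' θ'' φ'' : ℝ → ℝ)
    (hx : ∀ t ∈ U, HasDerivAt x (x' t) t)
    (hy : ∀ t ∈ U, HasDerivAt y (y' t) t)
    (hθ : ∀ t ∈ U, HasDerivAt θ (θ' t) t)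
    (hφ : ∀ t ∈ U, HasDerivAt φ (φ' t) t)
    (hx' : ∀ t ∈ U, HasDerivAt x' (x'' t) t)
    (hy' : ∀ t ∈ U, HasDerivAt y' (y'' t) t)
    (hθ' : ∀ t ∈ U, HasDerivAt θ' (θ'' t) t)
    (hφ' : ∀ t ∈ U, HasDerivAt φ' (φ'' t) t)
    (eqx : ∀ t ∈ U, x'' t =
      -(m * R ^ 2 / (2 * (I + m * R ^ 2))) * Real.sin (2 * φ t) * x' t * φ' t
      + (m * R ^ 2 / (I + m * R ^ 2)) * Real.cos (φ t) ^ 2 * y' t * φ' t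
      - R * Real.sin (φ t) * θ' t * φ' t)
    (eqy : ∀ t ∈ U, y'' t =
      -(m * R ^ 2 / (I + m * R ^ 2)) * Real.sin (φ t) ^ 2 * x' t * φ' t
      + (m * R ^ 2 / (2 * (I + m * R ^ 2))) * Real.sin (2 * φ t) * y' t * φ' t
      + R * Real.cos (φ t) * θ' t * φ' t)
    (eqθ : ∀ t ∈ U, θ'' t =
      -(m * R / (I + m * R ^ 2)) * Real.sin (φ t) * x' t * φ' t
      + (m * R / (I + m * R ^ 2)) * Real.cos (φ t) * y' t * φ' t)
    (eqφ : ∀ t ∈ U, φ'' t =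
      (m * R / J) * Real.sin (φ t) * x' t * θ' t
      - (m * R / J) * Real.cos (φ t) * y' t * θ' t) :
    (∀ s ∈ U, ∀ t ∈ U,
        x' s - R * θ' s * Real.cos (φ s) = x' t - R * θ' t * Real.cos (φ t)) ∧
    (∀ s ∈ U, ∀ t ∈ U,
        y' s - R * θ' s * Real.sin (φ s) = y' t - R * θ' t * Real.sin (φ t)) := by
  have hD : I + m * R ^ 2 ≠ 0 := by positivity
  constructor
  · refine eq_of_hasDerivAt_zero_of_ordConnected hUopen hUconn
      (f := fun t => x' t - R * θ' t * Real.cos (φ t)) fun t ht => ?_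
    refine ((hx' t ht).sub (((hθ' t ht).const_mul R).mul (hφ t ht).cos)).congr_deriv ?_
    rw [eqx t ht, eqθ t ht, Real.sin_two_mul]
    field_simp
    ring
  · refine eq_of_hasDerivAt_zero_of_ordConnected hUopen hUconn
      (f := fun t => y' t - R * θ' t * Real.sin (φ t)) fun t ht => ?_
    refine ((hy' t ht).sub (((hθ' t ht).const_mul R).mul (hφ t ht).sin)).congr_deriv ?_
    rw [eqy t ht, eqθ t ht, Real.sin_two_mul]
    field_simp
    ring
end

section
/- Let m, R, I, J > 0 and let (x, y, θ, φ) : U → ℝ⁴ be a twice differentiable curve on an open interval U ⊆ ℝ satisfying, for all t ∈ U, the geodesic equations of the principal metric of the vertical rolling disk: x'' = −(mR²/(2(I+mR²))) sin(2φ) x'φ' + (mR²/(I+mR²)) cos²(φ) y'φ' − R sin(φ) θ'φ', y'' = −(mR²/(I+mR²)) sin²(φ) x'φ' + (mR²/(2(I+mR²))) sin(2φ) y'φ' + R cos(φ) θ'φ', θ'' = −(mR/(I+mR²)) sin(φ) x'φ' + (mR/(I+mR²)) cos(φ) y'φ', φ'' = (mR/J) sin(φ) x'θ' − (mR/J) cos(φ)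 y'θ'. If at some t₀ ∈ U the rolling constraints x'(t₀) = R θ'(t₀) cos(φ(t₀)) and y'(t₀) = R θ'(t₀) sin(φ(t₀)) hold, then for every t ∈ U the constraints x' = R θ' cos φ, y' = R θ' sin φ hold and, moreover, x'' = −R sin(φ) θ'φ', y'' = R cos(φ) θ'φ', θ'' = 0 and φ'' = 0. -/
/-- A function with vanishing derivative on an open order-connected set which vanishes at one point
of the set vanishes on the whole set. -/
theorem eq_zero_of_hasDerivAt_zero {U : Set ℝ} (hUopen : IsOpen U) (hUconn : U.OrdConnected)
    {f : ℝ → ℝ} (hf : ∀ t ∈ U, HasDerivAt f 0 t) {t₀ : ℝ} (ht₀ : t₀ ∈ U) (h₀ : f t₀ = 0)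
    {t : ℝ} (ht : t ∈ U) : f t = 0 := by
  rw [← h₀]
  exact hUopen.is_const_of_deriv_eq_zero hUconn.isPreconnected
    (fun s hs => (hf s hs).differentiableAt.differentiableWithinAt)
    (fun s hs => (hf s hs).deriv) ht ht₀

/-- For the vertical rolling disk, a geodesic of the principal Riemannian
metric `h` whose velocity satisfies the rolling constraints at one time `t₀ ∈ U`
satisfies them for all `t ∈ U`, and along it the geodesic equations reduce to
`x'' = -R sin φ θ' φ'`, `y'' = R cos φ θ' φ'`, `θ'' = 0`, `φ'' = 0`. -/
theorem vertical_disk_geodesics_preserve_constraints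
    (m R I J : ℝ) (hm : 0 < m) (hR : 0 < R) (hI : 0 < I) (hJ : 0 < J)
    (U : Set ℝ) (hUopen : IsOpen U) (hUconn : U.OrdConnected)
    (x y θ φ x' y' θ' φ' x'' y'' θ'' φ'' : ℝ → ℝ)
    (hx : ∀ t ∈ U, HasDerivAt x (x' t) t)
    (hy : ∀ t ∈ U, HasDerivAt y (y' t) t)
    (hθ : ∀ t ∈ U, HasDerivAt θ (θ' t) t)
    (hφ : ∀ t ∈ U, HasDerivAt φ (φ' t) t)
    (hx' : ∀ t ∈ U, HasDerivAt x' (x'' t) t)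
    (hy' : ∀ t ∈ U, HasDerivAt y' (y'' t) t)
    (hθ' : ∀ t ∈ U, HasDerivAt θ' (θ'' t) t)
    (hφ' : ∀ t ∈ U, HasDerivAt φ' (φ'' t) t)
    (eqx : ∀ t ∈ U, x'' t =
      -(m * R ^ 2 / (2 * (I + m * R ^ 2))) * Real.sin (2 * φ t) * x' t * φ' t
      + (m * R ^ 2 / (I + m * R ^ 2)) * Real.cos (φ t) ^ 2 * y' t * φ' t
      - R * Real.sin (φ t) * θ' t * φ' t)
    (eqy : ∀ t ∈ U, y'' t =
      -(m * R ^ 2 / (I + m * R ^ 2)) * Real.sin (φ t) ^ 2 * x' t * φ' t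
      + (m * R ^ 2 / (2 * (I + m * R ^ 2))) * Real.sin (2 * φ t) * y' t * φ' t
      + R * Real.cos (φ t) * θ' t * φ' t)
    (eqθ : ∀ t ∈ U, θ'' t =
      -(m * R / (I + m * R ^ 2)) * Real.sin (φ t) * x' t * φ' t
      + (m * R / (I + m * R ^ 2)) * Real.cos (φ t) * y' t * φ' t)
    (eqφ : ∀ t ∈ U, φ'' t =
      (m * R / J) * Real.sin (φ t) * x' t * θ' t
      - (m * R / J) * Real.cos (φ t) * y' t * θ' t)
    (t₀ : ℝ) (ht₀ : t₀ ∈ U)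
    (hc₁ : x' t₀ = R * θ' t₀ * Real.cos (φ t₀))
    (hc₂ : y' t₀ = R * θ' t₀ * Real.sin (φ t₀)) :
    ∀ t ∈ U,
      x' t = R * θ' t * Real.cos (φ t) ∧
      y' t = R * θ' t * Real.sin (φ t) ∧
      x'' t = -R * Real.sin (φ t) * θ' t * φ' t ∧
      y'' t = R * Real.cos (φ t) * θ' t * φ' t ∧
      θ'' t = 0 ∧
      φ'' t = 0 := by
  have hD : I + m * R ^ 2 ≠ 0 := by positivity
  have hx_const : ∀ t ∈ U, HasDerivAt (fun s => x' s - R * θ' s * Real.cos (φ s)) 0 t := by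
    intro t ht
    refine ((hx' t ht).sub (((hθ' t ht).const_mul R).mul (hφ t ht).cos)).congr_deriv ?_
    rw [eqx t ht, eqθ t ht, Real.sin_two_mul]
    field_simp
    ring
  have hy_const : ∀ t ∈ U, HasDerivAt (fun s => y' s - R * θ' s * Real.sin (φ s)) 0 t := by
    intro t ht
    refine ((hy' t ht).sub (((hθ' t ht).const_mul R).mul (hφ t ht).sin)).congr_deriv ?_
    rw [eqy t ht, eqθ t ht, Real.sin_two_mul]
    field_simp
    ring
  intro t ht
  have h₁ : x' t = R * θ' t * Real.cos (φ t) :=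
    sub_eq_zero.1 (eq_zero_of_hasDerivAt_zero hUopen hUconn hx_const ht₀ (sub_eq_zero.2 hc₁) ht)
  have h₂ : y' t = R * θ' t * Real.sin (φ t) :=
    sub_eq_zero.1 (eq_zero_of_hasDerivAt_zero hUopen hUconn hy_const ht₀ (sub_eq_zero.2 hc₂) ht)
  refine ⟨h₁, h₂, ?_, ?_, ?_, ?_⟩
  · rw [eqx t ht, h₁, h₂, Real.sin_two_mul]
    field_simp
    ring
  · rw [eqy t ht, h₁, h₂, Real.sin_two_mul]
    field_simp
    ring
  · rw [eqθ t ht, h₁, h₂]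
    ring
  · rw [eqφ t ht, h₁, h₂]
    ring
end

section
/- Let m, R, I, J > 0 and let c = (x, y, θ, φ) : U → ℝ⁴ be a twice differentiable curve on an open interval U that satisfies the rolling constraints x' = R θ' cos φ, y' = R θ' sin φ for all t ∈ U. Then c satisfies the Euler–Lagrange equations of L_h((x,y,θ,φ),(v_x,v_y,v_θ,v_φ)) = ½(m v_x² + m v_y² + (I + 2mR²) v_θ² + J v_φ²) − mR cos(φ) v_x v_θ − mR sin(φ) v_y v_θ on U if and only if there exist λ₁, λ₂ : U → ℝ such that the Lagrange–d'Alembert equations m x'' = λ₁, m y'' = λ₂, I θ'' = −λ₁ R cos φ − λ₂ R sin φ, J φ'' = 0 hold on U. In other words, for curves satisfying the constraints, geodesics of the principal metric h coincide (without reparametrization) with the nonholonomic trajectories of the vertical rolling disk. -/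
/-- The derivative of a real quadratic polynomial function. -/
theorem deriv_quadratic (A B C : ℝ) (f : ℝ → ℝ) (hf : ∀ a, f a = A * a ^ 2 + B * a + C) (b : ℝ) :
    deriv f b = 2 * A * b + B := by
  obtain rfl : f = fun a => A * a ^ 2 + B * a + C := funext hf
  have h := ((((hasDerivAt_id b).pow 2).const_mul A).add ((hasDerivAt_id b).const_mul B)).add_const C
  have h' : HasDerivAt (fun a : ℝ => A * a ^ 2 + B * a + C) (2 * A * b + B) b := by
    refine h.congr_deriv ?_
    simp
    ring
  exact h'.deriv

/-- If `f` agrees on an open set with `g`, then its derivative there can only be that of `g`. -/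
theorem hasDerivAt_iff_eq_of_eqOn_isOpen {U : Set ℝ} (hU : IsOpen U) {f g : ℝ → ℝ} {d e t : ℝ}
    (ht : t ∈ U) (hfg : Set.EqOn f g U) (hg : HasDerivAt g d t) : HasDerivAt f e t ↔ d = e := by
  have hf : HasDerivAt f d t :=
    hg.congr_of_eventuallyEq (Filter.eventuallyEq_of_mem (hU.mem_nhds ht) hfg)
  exact ⟨fun h => hf.unique h, fun h => h ▸ hf⟩


/-- For a twice differentiable curve satisfying the rolling constraints of
the vertical rolling disk, the Euler–Lagrange equations of the kinetic Lagrangian `L_h`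
of the principal Riemannian metric hold if and only if the Lagrange–d'Alembert equations
of the nonholonomic system hold for some Lagrange multipliers `λ₁, λ₂`: constrained
geodesics of `h` coincide with nonholonomic trajectories, without reparametrization. -/
theorem vertical_disk_constrained_EL_iff_LdA
    (m R I J : ℝ) (hm : 0 < m) (hR : 0 < R) (hI : 0 < I) (hJ : 0 < J)
    (L : (ℝ × ℝ × ℝ × ℝ) → (ℝ × ℝ × ℝ × ℝ) → ℝ)
    (hL : ∀ q v : ℝ × ℝ × ℝ × ℝ, L q v =
      (m * v.1 ^ 2 + m * v.2.1 ^ 2 + (I + 2 * m * R ^ 2) * v.2.2.1 ^ 2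
        + J * v.2.2.2 ^ 2) / 2
      - m * R * Real.cos q.2.2.2 * v.1 * v.2.2.1
      - m * R * Real.sin q.2.2.2 * v.2.1 * v.2.2.1)
    (U : Set ℝ) (hUopen : IsOpen U) (hUconn : U.OrdConnected)
    (x y θ φ x' y' θ' φ' x'' y'' θ'' φ'' : ℝ → ℝ)
    (hx : ∀ t ∈ U, HasDerivAt x (x' t) t)
    (hy : ∀ t ∈ U, HasDerivAt y (y' t) t)
    (hθ : ∀ t ∈ U, HasDerivAt θ (θ' t) t)
    (hφ : ∀ t ∈ U, HasDerivAt φ (φ' t) t)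
    (hx' : ∀ t ∈ U, HasDerivAt x' (x'' t) t)
    (hy' : ∀ t ∈ U, HasDerivAt y' (y'' t) t)
    (hθ' : ∀ t ∈ U, HasDerivAt θ' (θ'' t) t)
    (hφ' : ∀ t ∈ U, HasDerivAt φ' (φ'' t) t)
    (hc₁ : ∀ t ∈ U, x' t = R * θ' t * Real.cos (φ t))
    (hc₂ : ∀ t ∈ U, y' t = R * θ' t * Real.sin (φ t)) :
    ((∀ t ∈ U, HasDerivAt
        (fun s => deriv (fun a => L (x s, y s, θ s, φ s) (a, y' s, θ' s, φ' s)) (x' s))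
        (deriv (fun a => L (a, y t, θ t, φ t) (x' t, y' t, θ' t, φ' t)) (x t)) t) ∧
     (∀ t ∈ U, HasDerivAt
        (fun s => deriv (fun a => L (x s, y s, θ s, φ s) (x' s, a, θ' s, φ' s)) (y' s))
        (deriv (fun a => L (x t, a, θ t, φ t) (x' t, y' t, θ' t, φ' t)) (y t)) t) ∧
     (∀ t ∈ U, HasDerivAt
        (fun s => deriv (fun a => L (x s, y s, θ s, φ s) (x' s, y' s, a, φ' s)) (θ' s))
        (deriv (fun a => L (x t, y t, a, φ t) (x' t, y' t, θ' t, φ' t)) (θ t)) t) ∧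
     (∀ t ∈ U, HasDerivAt
        (fun s => deriv (fun a => L (x s, y s, θ s, φ s) (x' s, y' s, θ' s, a)) (φ' s))
        (deriv (fun a => L (x t, y t, θ t, a) (x' t, y' t, θ' t, φ' t)) (φ t)) t)) ↔
    (∃ lam₁ lam₂ : ℝ → ℝ, ∀ t ∈ U,
        m * x'' t = lam₁ t ∧
        m * y'' t = lam₂ t ∧
        I * θ'' t = -lam₁ t * R * Real.cos (φ t) - lam₂ t * R * Real.sin (φ t) ∧
        J * φ'' t = 0) := by
  have hpx : ∀ t ∈ U,
      deriv (fun a => L (x t, y t, θ t, φ t) (a, y' t, θ' t, φ' t)) (x' t) = 0 := by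
    intro t ht
    rw [deriv_quadratic (m / 2) (-(m * R * Real.cos (φ t) * θ' t))
      (L (x t, y t, θ t, φ t) (0, y' t, θ' t, φ' t)) _ (fun a => by simp only [hL]; ring), hc₁ t ht]
    ring
  have hpy : ∀ t ∈ U,
      deriv (fun a => L (x t, y t, θ t, φ t) (x' t, a, θ' t, φ' t)) (y' t) = 0 := by
    intro t ht
    rw [deriv_quadratic (m / 2) (-(m * R * Real.sin (φ t) * θ' t))
      (L (x t, y t, θ t, φ t) (x' t, 0, θ' t, φ' t)) _ (fun a => by simp only [hL]; ring), hc₂ t ht]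
    ring
  have hpθ : ∀ t ∈ U, deriv (fun a => L (x t, y t, θ t, φ t) (x' t, y' t, a, φ' t)) (θ' t)
      = (I + m * R ^ 2) * θ' t := by
    intro t ht
    rw [deriv_quadratic ((I + 2 * m * R ^ 2) / 2)
      (-(m * R * Real.cos (φ t) * x' t) - m * R * Real.sin (φ t) * y' t)
      (L (x t, y t, θ t, φ t) (x' t, y' t, 0, φ' t)) _ (fun a => by simp only [hL]; ring),
      hc₁ t ht, hc₂ t ht]
    linear_combination (-m * R ^ 2 * θ' t) * Real.sin_sq_add_cos_sq (φ t)
  have hpφ : ∀ t ∈ U, deriv (fun a => L (x t, y t, θ t, φ t) (x' t, y' t, θ' t, a)) (φ' t)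
      = J * φ' t := by
    intro t _
    rw [deriv_quadratic (J / 2) 0
      (L (x t, y t, θ t, φ t) (x' t, y' t, θ' t, 0)) _ (fun a => by simp only [hL]; ring)]
    ring
  have hqx : ∀ t, deriv (fun a => L (a, y t, θ t, φ t) (x' t, y' t, θ' t, φ' t)) (x t) = 0 := by
    intro t
    simp only [hL, deriv_const]
  have hqy : ∀ t, deriv (fun a => L (x t, a, θ t, φ t) (x' t, y' t, θ' t, φ' t)) (y t) = 0 := by
    intro t
    simp only [hL, deriv_const]
  have hqθ : ∀ t, deriv (fun a => L (x t, y t, a, φ t) (x' t, y' t, θ' t, φ' t)) (θ t) = 0 := by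
    intro t
    simp only [hL, deriv_const]
  have hqφ : ∀ t ∈ U,
      deriv (fun a => L (x t, y t, θ t, a) (x' t, y' t, θ' t, φ' t)) (φ t) = 0 := by
    intro t ht
    simp only [hL]
    have hcos := (((Real.hasDerivAt_cos (φ t)).const_mul (m * R)).mul_const (x' t)).mul_const (θ' t)
    have hsin := (((Real.hasDerivAt_sin (φ t)).const_mul (m * R)).mul_const (y' t)).mul_const (θ' t)
    refine ((hcos.const_sub _).sub hsin).deriv.trans ?_
    rw [hc₁ t ht, hc₂ t ht]
    ring
  have hx'' : ∀ t ∈ U, x'' t = R * θ'' t * Real.cos (φ t) - R * θ' t * Real.sin (φ t) * φ' t := by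
    intro t ht
    have h := ((hθ' t ht).const_mul R).mul (hφ t ht).cos
    rw [← (hasDerivAt_iff_eq_of_eqOn_isOpen hUopen ht hc₁ h).1 (hx' t ht)]
    ring
  have hy'' : ∀ t ∈ U, y'' t = R * θ'' t * Real.sin (φ t) + R * θ' t * Real.cos (φ t) * φ' t := by
    intro t ht
    have h := ((hθ' t ht).const_mul R).mul (hφ t ht).sin
    rw [← (hasDerivAt_iff_eq_of_eqOn_isOpen hUopen ht hc₂ h).1 (hy' t ht)]
    ring
  have hforce : ∀ t ∈ U, m * x'' t * R * Real.cos (φ t) + m * y'' t * R * Real.sin (φ t)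
      = m * R ^ 2 * θ'' t := by
    intro t ht
    rw [hx'' t ht, hy'' t ht]
    linear_combination (m * R ^ 2 * θ'' t) * Real.sin_sq_add_cos_sq (φ t)
  have hELx := fun t (ht : t ∈ U) =>
    (hasDerivAt_iff_eq_of_eqOn_isOpen hUopen ht hpx (hasDerivAt_const t (0 : ℝ))).2 (hqx t).symm
  have hELy := fun t (ht : t ∈ U) =>
    (hasDerivAt_iff_eq_of_eqOn_isOpen hUopen ht hpy (hasDerivAt_const t (0 : ℝ))).2 (hqy t).symm
  have hELθ := fun t (ht : t ∈ U) => hasDerivAt_iff_eq_of_eqOn_isOpen hUopen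
    (e := deriv (fun a => L (x t, y t, a, φ t) (x' t, y' t, θ' t, φ' t)) (θ t)) ht hpθ
    ((hθ' t ht).const_mul (I + m * R ^ 2))
  have hELφ := fun t (ht : t ∈ U) => hasDerivAt_iff_eq_of_eqOn_isOpen hUopen
    (e := deriv (fun a => L (x t, y t, θ t, a) (x' t, y' t, θ' t, φ' t)) (φ t)) ht hpφ
    ((hφ' t ht).const_mul J)
  constructor
  · rintro ⟨-, -, h₃, h₄⟩
    refine ⟨fun t => m * x'' t, fun t => m * y'' t, fun t ht => ⟨rfl, rfl, ?_, ?_⟩⟩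
    · linear_combination ((hELθ t ht).1 (h₃ t ht)).trans (hqθ t) + hforce t ht
    · exact ((hELφ t ht).1 (h₄ t ht)).trans (hqφ t ht)
  · rintro ⟨lam₁, lam₂, h⟩
    refine ⟨hELx, hELy, fun t ht => (hELθ t ht).2 ?_, fun t ht => (hELφ t ht).2 ?_⟩
    · obtain ⟨h₁, h₂, h₃, -⟩ := h t ht
      rw [hqθ t]
      rw [← h₁, ← h₂] at h₃
      linear_combination h₃ - hforce t ht
    · exact (h t ht).2.2.2.trans (hqφ t ht).symm
end

section
/- Let (x, y, z) : U → ℝ³ be a twice differentiable curve on an open interval U ⊆ ℝ satisfying, for all t ∈ U, the geodesic equations of the principal metric of the nonholonomic particle: x'' = −y x'y' + y'z', y'' = ((1+y²)² y x'² − (1+y²)² x'z' + y y'²)/(1+y²), z'' = −y² x'y' + x'y' + y y'z'. Then the function t ↦ z'(t) − y(t) x'(t) is constant on U. -/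
/-- For the nonholonomic particle, along any twice differentiable solution
of the geodesic equations of the principal Riemannian metric `h` on an open interval
`U`, the quantity `z' - y x'` is constant on `U`. -/
theorem nonholonomic_particle_geodesics_constraint_function_constant
    (U : Set ℝ) (hUopen : IsOpen U) (hUconn : U.OrdConnected)
    (x y z x' y' z' x'' y'' z'' : ℝ → ℝ)
    (hx : ∀ t ∈ U, HasDerivAt x (x' t) t)
    (hy : ∀ t ∈ U, HasDerivAt y (y' t) t)
    (hz : ∀ t ∈ U, HasDerivAt z (z' t) t)
    (hx' : ∀ t ∈ U, HasDerivAt x' (x'' t) t)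
    (hy' : ∀ t ∈ U, HasDerivAt y' (y'' t) t)
    (hz' : ∀ t ∈ U, HasDerivAt z' (z'' t) t)
    (eqx : ∀ t ∈ U, x'' t = -y t * x' t * y' t + y' t * z' t)
    (eqy : ∀ t ∈ U, y'' t =
      ((1 + y t ^ 2) ^ 2 * y t * x' t ^ 2 - (1 + y t ^ 2) ^ 2 * x' t * z' t
        + y t * y' t ^ 2) / (1 + y t ^ 2))
    (eqz : ∀ t ∈ U, z'' t =
      -(y t) ^ 2 * x' t * y' t + x' t * y' t + y t * y' t * z' t) :
    ∀ s ∈ U, ∀ t ∈ U, z' s - y s * x' s = z' t - y t * x' t := by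
  have hderiv : ∀ t ∈ U, HasDerivAt (fun t => z' t - y t * x' t) 0 t := by
    intro t ht
    refine ((hz' t ht).sub ((hy t ht).mul (hx' t ht))).congr_deriv ?_
    rw [eqz t ht, eqx t ht]
    ring
  intro s hs t ht
  exact hUopen.is_const_of_deriv_eq_zero hUconn.isPreconnected
    (fun r hr => (hderiv r hr).differentiableAt.differentiableWithinAt)
    (fun r hr => (hderiv r hr).deriv) hs ht
end

section
/- Let (x, y, z) : U → ℝ³ be a twice differentiable curve on an open interval U ⊆ ℝ satisfying, for all t ∈ U, the geodesic equations x'' = −y x'y' + y'z', y'' = ((1+y²)² y x'² − (1+y²)² x'z' + y y'²)/(1+y²), z'' = −y² x'y' + x'y' + y y'z'. If at some t₀ ∈ U the constraint z'(t₀) = y(t₀) x'(t₀) holds, then for all t ∈ U one has z' = y x' and, moreover, x'' = 0, y'' = y y'²/(1+y²) and z'' = x'y'. -/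
/-- For the nonholonomic particle, a geodesic of the principal Riemannian
metric `h` whose velocity satisfies the constraint `z' = y x'` at one time `t₀ ∈ U`
satisfies it for all `t ∈ U`, and along it the geodesic equations reduce to
`x'' = 0`, `y'' = y y'²/(1+y²)`, `z'' = x' y'`. -/
theorem nonholonomic_particle_geodesics_preserve_constraint
    (U : Set ℝ) (hUopen : IsOpen U) (hUconn : U.OrdConnected)
    (x y z x' y' z' x'' y'' z'' : ℝ → ℝ)
    (hx : ∀ t ∈ U, HasDerivAt x (x' t) t)
    (hy : ∀ t ∈ U, HasDerivAt y (y' t) t)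
    (hz : ∀ t ∈ U, HasDerivAt z (z' t) t)
    (hx' : ∀ t ∈ U, HasDerivAt x' (x'' t) t)
    (hy' : ∀ t ∈ U, HasDerivAt y' (y'' t) t)
    (hz' : ∀ t ∈ U, HasDerivAt z' (z'' t) t)
    (eqx : ∀ t ∈ U, x'' t = -y t * x' t * y' t + y' t * z' t)
    (eqy : ∀ t ∈ U, y'' t =
      ((1 + y t ^ 2) ^ 2 * y t * x' t ^ 2 - (1 + y t ^ 2) ^ 2 * x' t * z' t
        + y t * y' t ^ 2) / (1 + y t ^ 2))
    (eqz : ∀ t ∈ U, z'' t =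
      -(y t) ^ 2 * x' t * y' t + x' t * y' t + y t * y' t * z' t)
    (t₀ : ℝ) (ht₀ : t₀ ∈ U) (hc : z' t₀ = y t₀ * x' t₀) :
    ∀ t ∈ U,
      z' t = y t * x' t ∧
      x'' t = 0 ∧
      y'' t = y t * y' t ^ 2 / (1 + y t ^ 2) ∧
      z'' t = x' t * y' t := by
  have hw : ∀ t ∈ U, HasDerivAt (fun s => z' s - y s * x' s) 0 t := fun t ht => by
    refine ((hz' t ht).sub ((hy t ht).mul (hx' t ht))).congr_deriv ?_
    rw [eqx t ht, eqz t ht]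
    ring
  intro t ht
  have hconst : z' t - y t * x' t = z' t₀ - y t₀ * x' t₀ :=
    hUopen.is_const_of_deriv_eq_zero hUconn.isPreconnected
      (fun s hs => (hw s hs).differentiableAt.differentiableWithinAt)
      (fun s hs => (hw s hs).deriv) ht ht₀
  have hct : z' t = y t * x' t := by linarith
  refine ⟨hct, ?_, ?_, ?_⟩
  · rw [eqx t ht, hct]
    ring
  · rw [eqy t ht, hct]
    congr 1
    ring
  · rw [eqz t ht, hct]
    ring
end

section
/- Let (x, y, z, v_x, v_y, v_z) : U → ℝ⁶ be differentiable functions on an open interval U ⊆ ℝ satisfying, for all t ∈ U: x' = √(1+y²) v_x, y' = √(1+y²) v_y, z' = √(1+y²) v_z, v_x' = −y v_x v_y / √(1+y²), v_y' = 0, v_z' = v_x v_y / √(1+y²), together with v_z = y v_x on U. Define v̄_x = √(1+y²) v_x, v̄_y = √(1+y²) v_y, v̄_z = √(1+y²) v_z. Then for all t ∈ U: x' = v̄_x, y' = v̄_y, z' = v̄_z, v̄_x' = 0, v̄_y' = y v̄_y² / (1+y²), and v̄_z' = v̄_x v̄_y. In other words, the time-rescaled nonholonomic flow of the nonholonomic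 particle coincides, after the change of variables v̄ = √(1+y²) v, with the reduced geodesic flow of the principal metric restricted to the constraint distribution. -/
/-- Along a curve with `y' = √(1+y²) w`, one has `(√(1+y²))' = y w`. -/
theorem hasDerivAt_sqrt_one_add_sq_of_rescaled {y : ℝ → ℝ} {w t : ℝ}
    (hy : HasDerivAt y (Real.sqrt (1 + y t ^ 2) * w) t) :
    HasDerivAt (fun r => Real.sqrt (1 + y r ^ 2)) (y t * w) t := by
  have hpos : 0 < 1 + y t ^ 2 := by positivity
  have hne : Real.sqrt (1 + y t ^ 2) ≠ 0 := (Real.sqrt_pos.mpr hpos).ne'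
  refine (((hy.fun_pow 2).const_add 1).sqrt hpos.ne').congr_deriv ?_
  field_simp
  norm_num
  ring

/-- For the nonholonomic particle, the time-rescaled nonholonomic flow
(the integral-curve system of `√(1+y²) Γ_{(g,D)}`), after the change of variables
`v̄ = √(1+y²) v` and on the constraint `v_z = y v_x`, coincides with the first-order
form of the geodesic equations of the principal metric restricted to the constraint
distribution: `x' = v̄_x`, `y' = v̄_y`, `z' = v̄_z`, `v̄_x' = 0`,
`v̄_y' = y v̄_y²/(1+y²)`, `v̄_z' = v̄_x v̄_y`. -/
theorem nonholonomic_particle_rescaled_flow_is_geodesic_flow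
    (U : Set ℝ) (hUopen : IsOpen U) (hUconn : U.OrdConnected)
    (x y z vx vy vz : ℝ → ℝ)
    (hx : ∀ t ∈ U, HasDerivAt x (Real.sqrt (1 + y t ^ 2) * vx t) t)
    (hy : ∀ t ∈ U, HasDerivAt y (Real.sqrt (1 + y t ^ 2) * vy t) t)
    (hz : ∀ t ∈ U, HasDerivAt z (Real.sqrt (1 + y t ^ 2) * vz t) t)
    (hvx : ∀ t ∈ U, HasDerivAt vx (-y t * vx t * vy t / Real.sqrt (1 + y t ^ 2)) t)
    (hvy : ∀ t ∈ U, HasDerivAt vy 0 t)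
    (hvz : ∀ t ∈ U, HasDerivAt vz (vx t * vy t / Real.sqrt (1 + y t ^ 2)) t)
    (hconstraint : ∀ t ∈ U, vz t = y t * vx t)
    (vbx vby vbz : ℝ → ℝ)
    (hvbx : ∀ t, vbx t = Real.sqrt (1 + y t ^ 2) * vx t)
    (hvby : ∀ t, vby t = Real.sqrt (1 + y t ^ 2) * vy t)
    (hvbz : ∀ t, vbz t = Real.sqrt (1 + y t ^ 2) * vz t) :
    ∀ t ∈ U,
      HasDerivAt x (vbx t) t ∧
      HasDerivAt y (vby t) t ∧
      HasDerivAt z (vbz t) t ∧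
      HasDerivAt vbx 0 t ∧
      HasDerivAt vby (y t * vby t ^ 2 / (1 + y t ^ 2)) t ∧
      HasDerivAt vbz (vbx t * vby t) t := by
  intro t ht
  have hpos : 0 < 1 + y t ^ 2 := by positivity
  have hne : Real.sqrt (1 + y t ^ 2) ≠ 0 := (Real.sqrt_pos.mpr hpos).ne'
  have hsq : Real.sqrt (1 + y t ^ 2) ^ 2 = 1 + y t ^ 2 := Real.sq_sqrt hpos.le
  have hs := hasDerivAt_sqrt_one_add_sq_of_rescaled (hy t ht)
  refine ⟨hvbx t ▸ hx t ht, hvby t ▸ hy t ht, hvbz t ▸ hz t ht, ?_, ?_, ?_⟩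
  · rw [funext hvbx]
    refine (hs.fun_mul (hvx t ht)).congr_deriv ?_
    rw [mul_div_cancel₀ _ hne]
    ring
  · rw [funext hvby]
    refine (hs.fun_mul (hvy t ht)).congr_deriv ?_
    rw [mul_pow, hsq]
    field_simp
    ring
  · rw [funext hvbz, hvbx, hvby]
    refine (hs.fun_mul (hvz t ht)).congr_deriv ?_
    rw [mul_div_cancel₀ _ hne, hconstraint t ht]
    linear_combination -(vx t * vy t) * hsq
end
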